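/- Let K ∈ ℝ^{N×N} be symmetric positive definite, μ > 0, and y = f_X + δ with f_X, δ ∈ ℝ^N. Then for every vector v ∈ ℝ^N, y^T (K + μI)^{-1} v = f_X^T K^{-1} v − y^T (K + (1/μ) K K)^{-1} v + δ^T K^{-1} v. In particular, the kernel ridge regression prediction decomposes as s*(x) = s̄(x) − y^T (K + (1/μ)KK)^{-1} K_{Xx} + δ^T K^{-1} K_{Xx}, where s̄(x) = f_X^T K^{-1} K_{Xx}. -/

import Mathlib

open Matrix

/-- The resolvent identity `(K + μI)⁻¹ = K⁻¹ − (K + (1/μ)KK)⁻¹`. -/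
theorem Matrix.inv_add_smul_one_eq_sub {n F : Type*} [Fintype n] [DecidableEq n] [Field F]
    {K : Matrix n n F} {μ : F} (hμ : μ ≠ 0) (hK : IsUnit K)
    (hA : IsUnit (K + μ • (1 : Matrix n n F))) :
    (K + μ • (1 : Matrix n n F))⁻¹ = K⁻¹ - (K + (1 / μ) • (K * K))⁻¹ := by
  rw [isUnit_iff_isUnit_det] at hK hA
  have hinv : (K + (1 / μ) • (K * K))⁻¹ = μ • ((K + μ • (1 : Matrix n n F))⁻¹ * K⁻¹) := by
    apply inv_eq_left_inv
    have hfac : K + (1 / μ) • (K * K) = (1 / μ) • (K * (K + μ • (1 : Matrix n n F))) := by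
      simp [mul_add, smul_smul, hμ, add_comm]
    rw [hfac, smul_mul_smul_comm, mul_one_div_cancel hμ, one_smul, mul_assoc,
      nonsing_inv_mul_cancel_left _ _ hK, nonsing_inv_mul _ hA]
  rw [hinv, eq_sub_iff_add_eq]
  calc (K + μ • (1 : Matrix n n F))⁻¹ + μ • ((K + μ • (1 : Matrix n n F))⁻¹ * K⁻¹)
      = (K + μ • (1 : Matrix n n F))⁻¹ * ((K + μ • (1 : Matrix n n F)) * K⁻¹) := by
        rw [add_mul, mul_nonsing_inv _ hK, mul_add, mul_one, smul_mul_assoc, one_mul,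
          mul_smul_comm]
    _ = K⁻¹ := nonsing_inv_mul_cancel_left _ _ hA

/-- Woodbury-type decomposition of the kernel ridge regression prediction: for symmetric
positive-definite `K`, `μ > 0`, and `y = f_X + δ`, one has
`y^T (K + μI)⁻¹ v = f_X^T K⁻¹ v − y^T (K + (1/μ) K K)⁻¹ v + δ^T K⁻¹ v` for every `v`;
in particular, with `v = K_{Xx}` this is the decomposition
`s*(x) = s̄(x) − y^T (K + (1/μ)KK)⁻¹ K_{Xx} + δ^T K⁻¹ K_{Xx}`. -/
theorem krr_prediction_decomposition {N : ℕ}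
    (K : Matrix (Fin N) (Fin N) ℝ) (hK : K.PosDef)
    (μ : ℝ) (hμ : 0 < μ)
    (fX δ y : Fin N → ℝ) (hy : y = fX + δ) :
    ∀ v : Fin N → ℝ,
      y ⬝ᵥ (K + μ • (1 : Matrix (Fin N) (Fin N) ℝ))⁻¹ *ᵥ v =
        fX ⬝ᵥ K⁻¹ *ᵥ v - y ⬝ᵥ (K + (1 / μ) • (K * K))⁻¹ *ᵥ v + δ ⬝ᵥ K⁻¹ *ᵥ v := by
  intro v
  have hA : (K + μ • (1 : Matrix (Fin N) (Fin N) ℝ)).PosDef := hK.add (PosDef.one.smul hμ)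
  rw [inv_add_smul_one_eq_sub hμ.ne' hK.isUnit hA.isUnit, sub_mulVec, dotProduct_sub]
  nth_rewrite 1 [hy]
  rw [add_dotProduct]
  ring
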